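/- arXiv:2411.06013 — 2 statements merged into one kernel-verified Lean document; each statement's English description precedes it below -/
import Mathlib

section
/- Let d ≥ 2 and let ρ be a Hermitian complex matrix indexed by Fin d × Fin d with tr(ρ) = 1, with reduced matrices ρ_A and ρ_B. Fix observables as follows: Hermitian N_A, N_B with tr(N_X) = 0, tr(N_X²) = d; real observables M_A, M_B with tr(M_X) = 0, tr(M_X²) = d; imaginary observables M̂_A, M̂_B with tr(M̂_X²) = d; and define the moments R = ∬ (tr((U_A⊗U_B)ρ(U_A⊗U_B)ᴴ(N_A⊗N_B)))² dμ_U dμ_U, Q = ∬ (tr((O_A⊗O_B)ρ(O_Aᵀ⊗O_Bᵀ)(M_A⊗M_B)))² dμ_O dμ_O, Q̂ = ∬ (tr((O_A⊗O_B)ρ(O_Aᵀ⊗O_Bᵀ)(M̂_A⊗M̂_B)))² dμ_O dμ_O, Q̂_A = ∫ (tr(O·ρ_A·Oᵀ·M̂_A))² dμ_O, Q̂_B = ∫ (tr(O·ρ_B·Oᵀ·M̂_B))² dμ_O. Then ρᵀ = ρ if and only if Q̂_A = 0, Q̂_B = 0, and (d²−1)²·R = L²·Q + L̂²·Q̂,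 where L = (d−1)(d+2)/2 and L̂ = d(d−1)/2. -/
open MeasureTheory Matrix Kronecker

/-- Entrywise coercion of a real orthogonal matrix to a complex matrix. -/
def OC {d : ℕ} (O : Matrix.orthogonalGroup (Fin d) ℝ) : Matrix (Fin d) (Fin d) ℂ :=
  (O : Matrix (Fin d) (Fin d) ℝ).map Complex.ofReal

/-- The reduced matrix on the first factor: `(ρ_A)_{j,j'} = Σ_k ρ_{(j,k),(j',k)}`. -/
noncomputable def redA {d : ℕ} (ρ : Matrix (Fin d × Fin d) (Fin d × Fin d) ℂ) :
    Matrix (Fin d) (Fin d) ℂ :=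
  Matrix.of fun j j' => ∑ k, ρ (j, k) (j', k)

/-- The reduced matrix on the second factor: `(ρ_B)_{k,k'} = Σ_j ρ_{(j,k),(j,k')}`. -/
noncomputable def redB {d : ℕ} (ρ : Matrix (Fin d × Fin d) (Fin d × Fin d) ℂ) :
    Matrix (Fin d) (Fin d) ℂ :=
  Matrix.of fun k k' => ∑ j, ρ (j, k) (j, k')

section Isotropic

variable {d : ℕ}

/-- The reflection `1 - c • v vᵀ` is orthogonal when `c * (v ⬝ᵥ v) = 2`. -/
lemma reflection_mul_transpose (v : Fin d → ℝ) (c : ℝ) (h : c * (v ⬝ᵥ v) = 2) :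
    (1 - c • vecMulVec v v) * (1 - c • vecMulVec v v)ᵀ = 1 := by
  have : (vecMulVec v v)ᵀ = vecMulVec v v := transpose_vecMulVec v v
  rw [transpose_sub, transpose_smul, this, transpose_one, sub_mul, mul_sub, mul_sub,
    smul_mul_smul_comm, vecMulVec_mul_vecMulVec]
  ext i j
  simp [vecMulVec_apply]
  linear_combination c * v i * v j * h

/-- A bilinear form on matrices that is invariant under simultaneous real orthogonal
conjugation. -/
def OrthInvariant (B : Matrix (Fin d) (Fin d) ℂ →ₗ[ℂ] Matrix (Fin d) (Fin d) ℂ →ₗ[ℂ] ℂ) : Prop :=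
  ∀ A : Matrix (Fin d) (Fin d) ℝ, A * Aᵀ = 1 → ∀ σ τ,
    B (A.map Complex.ofReal * σ * (A.map Complex.ofReal)ᵀ)
      (A.map Complex.ofReal * τ * (A.map Complex.ofReal)ᵀ) = B σ τ

variable {B : Matrix (Fin d) (Fin d) ℂ →ₗ[ℂ] Matrix (Fin d) (Fin d) ℂ →ₗ[ℂ] ℂ}

lemma OrthInvariant.vecMulVec (hB : OrthInvariant B) {A : Matrix (Fin d) (Fin d) ℝ}
    (hA : A * Aᵀ = 1) (x y z w : Fin d → ℂ) :
    B (vecMulVec (A.map Complex.ofReal *ᵥ x) (A.map Complex.ofReal *ᵥ y))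
      (vecMulVec (A.map Complex.ofReal *ᵥ z) (A.map Complex.ofReal *ᵥ w)) =
    B (vecMulVec x y) (vecMulVec z w) := by
  rw [← hB A hA (Matrix.vecMulVec x y)]
  simp only [mul_vecMulVec, vecMulVec_mul, vecMul_transpose]

/-- The four-index tensor of a bilinear form on matrices. -/
def tensor (B : Matrix (Fin d) (Fin d) ℂ →ₗ[ℂ] Matrix (Fin d) (Fin d) ℂ →ₗ[ℂ] ℂ)
    (i j k l : Fin d) : ℂ := B (single i j 1) (single k l 1)

lemma apply_eq_sum_tensor (σ τ : Matrix (Fin d) (Fin d) ℂ) :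
    B σ τ = ∑ i, ∑ j, ∑ k, ∑ l, σ i j * τ k l * tensor B i j k l := by
  have h : ∀ M : Matrix (Fin d) (Fin d) ℂ, M = ∑ i, ∑ j, M i j • single i j (1 : ℂ) := fun M => by
    conv_lhs => rw [matrix_eq_sum_single M]
    simp [smul_single]
  conv_lhs => rw [h σ]
  simp only [map_sum, map_smul, LinearMap.sum_apply, LinearMap.smul_apply, smul_eq_mul]
  refine Finset.sum_congr rfl fun i _ => Finset.sum_congr rfl fun j _ => ?_
  conv_lhs => rw [h τ]
  simp only [map_sum, map_smul, smul_eq_mul, Finset.mul_sum, tensor, mul_assoc]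

lemma OrthInvariant.tensor_reflection (hB : OrthInvariant B) (v : Fin d → ℝ) (c : ℝ)
    (h : c * (v ⬝ᵥ v) = 2) (i j k l : Fin d) :
    B (Matrix.vecMulVec (Pi.single i 1 - (c * v i : ℂ) • fun a => (v a : ℂ))
        (Pi.single j 1 - (c * v j : ℂ) • fun a => (v a : ℂ)))
      (Matrix.vecMulVec (Pi.single k 1 - (c * v k : ℂ) • fun a => (v a : ℂ))
        (Pi.single l 1 - (c * v l : ℂ) • fun a => (v a : ℂ))) = tensor B i j k l := by
  have key : ∀ i : Fin d, ((1 - c • Matrix.vecMulVec v v).map Complex.ofReal) *ᵥ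
      (Pi.single i 1 : Fin d → ℂ) = Pi.single i 1 - (c * v i : ℂ) • fun a => (v a : ℂ) := by
    intro i
    ext a
    simp [vecMulVec_apply, Matrix.one_apply, Pi.single_apply]
    split_ifs <;> (push_cast; ring)
  rw [← key, ← key, ← key, ← key, hB.vecMulVec (reflection_mul_transpose v c h), tensor,
    single_eq_single_vecMulVec_single, single_eq_single_vecMulVec_single]

/-- Flipping the sign of the `m`-th coordinate. -/
lemma OrthInvariant.tensor_flip (hB : OrthInvariant B) (m i j k l : Fin d) :
    (if i = m then -1 else 1) * (if j = m then -1 else 1) * (if k = m then -1 else 1) *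
      (if l = m then -1 else 1) * tensor B i j k l = tensor B i j k l := by
  have key : ∀ i : Fin d, (Pi.single i 1 - (((2 : ℝ) : ℂ) * ((Pi.single m 1 : Fin d → ℝ) i : ℂ)) •
      fun a => ((Pi.single m 1 : Fin d → ℝ) a : ℂ)) =
      (if i = m then (-1 : ℂ) else 1) • (Pi.single i 1 : Fin d → ℂ) := by
    intro i
    ext a
    by_cases h : i = m
    · subst h
      by_cases h' : a = i
      · simp [h']; norm_num
      · simp [h']
    · simp [h]
  have := hB.tensor_reflection (Pi.single m 1) 2 (by simp) i j k l
  rw [key, key, key, key] at this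
  simp only [smul_vecMulVec, vecMulVec_smul, map_smul, LinearMap.smul_apply, smul_eq_mul,
    ← single_eq_single_vecMulVec_single] at this
  simp only [tensor] at this ⊢
  linear_combination this

/-- Exchanging two coordinates. -/
lemma OrthInvariant.tensor_swap (hB : OrthInvariant B) (m n i j k l : Fin d) :
    tensor B (Equiv.swap m n i) (Equiv.swap m n j) (Equiv.swap m n k) (Equiv.swap m n l) =
      tensor B i j k l := by
  by_cases hmn : m = n
  · subst hmn; simp
  have key : ∀ i : Fin d, (Pi.single i 1 - (((1 : ℝ) : ℂ) *
      ((Pi.single m 1 - Pi.single n 1 : Fin d → ℝ) i : ℂ)) •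
      fun a => ((Pi.single m 1 - Pi.single n 1 : Fin d → ℝ) a : ℂ)) =
      (Pi.single (Equiv.swap m n i) 1 : Fin d → ℂ) := by
    intro i
    ext a
    rw [Equiv.swap_apply_def]
    by_cases h : i = m
    · subst h; simp [hmn, Pi.single_apply]; split_ifs <;> simp
    by_cases h' : i = n
    · subst h'; simp [h, Pi.single_apply]; split_ifs <;> simp
    · simp [h, h', Pi.single_apply]
  have := hB.tensor_reflection (Pi.single m 1 - Pi.single n 1) 1
    (by simp [hmn, Ne.symm hmn]; norm_num) i j k l
  rw [key, key, key, key] at this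
  simp only [← single_eq_single_vecMulVec_single] at this
  exact this

/-- The relation between the diagonal and off-diagonal entries of an invariant tensor. -/
lemma OrthInvariant.tensor_diag (hB : OrthInvariant B) {i j : Fin d} (hij : i ≠ j) :
    2 * tensor B i i i i = tensor B i i j j + tensor B j j i i + tensor B i j i j +
      tensor B j i j i + tensor B i j j i + tensor B j i i j := by
  have key : (Pi.single i 1 - (((2 / 5 : ℝ) : ℂ) *
      ((Pi.single i 1 - (2 : ℝ) • Pi.single j 1 : Fin d → ℝ) i : ℂ)) •
      fun a => ((Pi.single i 1 - (2 : ℝ) • Pi.single j 1 : Fin d → ℝ) a : ℂ)) =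
      (3 / 5 : ℂ) • (Pi.single i 1 : Fin d → ℂ) + (4 / 5 : ℂ) • Pi.single j 1 := by
    ext a
    by_cases h : a = i
    · subst h; simp [hij]; norm_num
    by_cases h' : a = j
    · subst h'; simp [h, Ne.symm h]; norm_num
    · simp [h, h']
  have := hB.tensor_reflection (Pi.single i 1 - (2 : ℝ) • Pi.single j 1) (2 / 5)
    (by simp [hij, Ne.symm hij]; norm_num) i i i i
  rw [key] at this
  simp only [smul_vecMulVec, vecMulVec_smul, add_vecMulVec, vecMulVec_add, map_smul, map_add,
    LinearMap.add_apply, LinearMap.smul_apply, smul_eq_mul,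
    ← single_eq_single_vecMulVec_single] at this
  simp only [← show ∀ i j k l, tensor B i j k l = B (single i j 1) (single k l 1) from
    fun _ _ _ _ => rfl] at this
  have hs := hB.tensor_swap i j i i i i
  rw [Equiv.swap_apply_left] at hs
  have h1 := hB.tensor_flip i i j j j
  have h2 := hB.tensor_flip i j i j j
  have h3 := hB.tensor_flip i j j i j
  have h4 := hB.tensor_flip i j j j i
  have h5 := hB.tensor_flip j j i i i
  have h6 := hB.tensor_flip j i j i i
  have h7 := hB.tensor_flip j i i j i
  have h8 := hB.tensor_flip j i i i j
  simp only [if_true, hij, Ne.symm hij, if_false] at h1 h2 h3 h4 h5 h6 h7 h8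
  linear_combination (-625 / 144) * this + (256 / 144) * hs - (2 / 3) * (h1 + h2 + h3 + h4)
    - (3 / 8) * (h5 + h6 + h7 + h8)

/-- A pair of distinct indices can be moved to any other such pair. -/
lemma OrthInvariant.tensor_comp (hB : OrthInvariant B) {i j k l : Fin d} (hij : i ≠ j)
    (hkl : k ≠ l) : tensor B i i j j = tensor B k k l l ∧ tensor B i j i j = tensor B k l k l ∧
      tensor B i j j i = tensor B k l l k := by
  obtain ⟨π, hi, hj, hπ⟩ : ∃ π : Fin d → Fin d, π i = k ∧ π j = l ∧
      ∀ a b c e, tensor B (π a) (π b) (π c) (π e) = tensor B a b c e := by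
    have hm : Equiv.swap i k j ≠ k := fun h => hij
      ((Equiv.swap i k).injective (by rw [h, Equiv.swap_apply_left]))
    refine ⟨fun a => Equiv.swap (Equiv.swap i k j) l (Equiv.swap i k a), ?_, ?_, ?_⟩
    · simp only [Equiv.swap_apply_left]
      exact Equiv.swap_apply_of_ne_of_ne hm.symm hkl
    · simp
    · intro a b c e
      simp only [hB.tensor_swap]
  rw [← hi, ← hj]
  simp only [hπ, and_self]

/-- An invariant tensor is a combination of the three pairings of its indices. -/
lemma OrthInvariant.exists_tensor_eq (hB : OrthInvariant B) (hd : 2 ≤ d) :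
    ∃ a b c : ℂ, ∀ i j k l, tensor B i j k l =
      (if i = l ∧ j = k then a else 0) + (if i = k ∧ j = l then b else 0) +
        (if i = j ∧ k = l then c else 0) := by
  let x : Fin d := ⟨0, by omega⟩
  let y : Fin d := ⟨1, by omega⟩
  have hxy : x ≠ y := by simp [x, y]
  refine ⟨tensor B x y y x, tensor B x y x y, tensor B x x y y, fun i j k l => ?_⟩
  have odd : ∀ m, (if i = m then (-1 : ℂ) else 1) * (if j = m then -1 else 1) *
      (if k = m then -1 else 1) * (if l = m then -1 else 1) = -1 → tensor B i j k l = 0 := by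
    intro m hm
    have := hB.tensor_flip m i j k l
    rw [hm] at this
    linear_combination (-1 / 2) * this
  by_cases hij : i = j
  · subst hij
    by_cases hkl : k = l
    · subst hkl
      by_cases hik : i = k
      · subst hik
        simp only [and_self, if_true]
        obtain ⟨w, hw⟩ : ∃ w, i ≠ w := by
          by_cases h : i = x
          · exact ⟨y, h ▸ hxy⟩
          · exact ⟨x, h⟩
        have h := hB.tensor_diag hw
        have h1 := hB.tensor_comp hw hxy
        have h2 := hB.tensor_comp hw.symm hxy
        rw [h1.1, h1.2.1, h1.2.2, h2.1, h2.2.1, h2.2.2] at h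
        linear_combination (1 / 2) * h
      · simp [hik, (hB.tensor_comp hik hxy).1]
    · have h0 : tensor B i i k l = 0 := by
        by_cases hil : i = l
        · exact odd k (by subst hil; simp [Ne.symm hkl])
        · exact odd l (by simp [hil, hkl])
      rw [h0, if_neg, if_neg, if_neg] <;> simp <;> grind
  · by_cases h1 : i = l ∧ j = k
    · obtain ⟨rfl, rfl⟩ := h1
      simp [hij, (hB.tensor_comp hij hxy).2.2]
    by_cases h2 : i = k ∧ j = l
    · obtain ⟨rfl, rfl⟩ := h2
      simp [hij, Ne.symm hij, (hB.tensor_comp hij hxy).2.1]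
    have h0 : tensor B i j k l = 0 := by
      by_cases hik : i = k
      · subst hik
        by_cases hil : i = l
        · exact odd j (by subst hil; simp [hij])
        · exact odd l (by grind)
      · by_cases hil : i = l
        · subst hil
          exact odd k (by grind)
        · exact odd i (by grind)
    simp [h0, h1, h2, hij]

/-- An invariant bilinear form is a combination of the three elementary ones. -/
lemma OrthInvariant.exists_eq (hB : OrthInvariant B) (hd : 2 ≤ d) :
    ∃ a b c : ℂ, ∀ σ τ, B σ τ =
      a * (σ * τ).trace + b * (σ * τᵀ).trace + c * (σ.trace * τ.trace) := by
  obtain ⟨a, b, c, h⟩ := hB.exists_tensor_eq hd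
  refine ⟨a, b, c, fun σ τ => ?_⟩
  rw [apply_eq_sum_tensor]
  simp only [h, mul_add, Finset.sum_add_distrib, mul_ite, mul_zero, ite_and]
  congr 1
  · congr 1
    · simp [Finset.sum_ite_eq, trace, mul_apply, Finset.mul_sum, mul_comm]
    · simp [Finset.sum_ite_eq, trace, mul_apply, Finset.mul_sum, mul_comm]
  · simp [trace, Finset.mul_sum, mul_comm]
    exact Finset.sum_comm

end Isotropic

section Moments

lemma continuous_trace_mul {d : ℕ} {Ω : Type*} [TopologicalSpace Ω]
    {X : Ω → Matrix (Fin d) (Fin d) ℂ} (hX : Continuous X)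
    (σ : Matrix (Fin d) (Fin d) ℂ) : Continuous fun ω => (σ * X ω).trace :=
  (continuous_const.matrix_mul hX).matrix_trace

variable {d : ℕ} {Ω : Type*} [MeasurableSpace Ω] (μ : Measure Ω)

/-- The second moment of the random matrix `X` is the isotropic form with coefficients
`a`, `b`, `c`. -/
def IsMoment (X : Ω → Matrix (Fin d) (Fin d) ℂ) (a b c : ℂ) : Prop :=
  ∀ σ τ : Matrix (Fin d) (Fin d) ℂ, ∫ ω, (σ * X ω).trace * (τ * X ω).trace ∂μ =
    a * (σ * τ).trace + b * (σ * τᵀ).trace + c * (σ.trace * τ.trace)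

variable {μ} {X : Ω → Matrix (Fin d) (Fin d) ℂ} {a b c : ℂ}

lemma IsMoment.coeff_trace (h : IsMoment μ X a b c) (hd : 2 ≤ d) (hX : ∀ ω, (X ω).trace = 0) :
    a + b + c * d = 0 := by
  have := h (single ⟨0, by omega⟩ ⟨0, by omega⟩ 1) 1
  simp [hX] at this
  linear_combination -this

lemma IsMoment.apply_single (h : IsMoment μ X a b c) {i j : Fin d} (hij : i ≠ j) :
    ∫ ω, (single i j 1 * X ω).trace * (single i j 1 * X ω).trace ∂μ = b := by
  rw [h]; simp [hij, Ne.symm hij]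

lemma IsMoment.apply_single_swap (h : IsMoment μ X a b c) {i j : Fin d} (hij : i ≠ j) :
    ∫ ω, (single i j 1 * X ω).trace * (single j i 1 * X ω).trace ∂μ = a := by
  rw [h]; simp [hij, Ne.symm hij]

lemma IsMoment.coeff_transpose (h : IsMoment μ X a b c) (hd : 2 ≤ d) (s : ℂ)
    (hX : ∀ ω, (X ω)ᵀ = s • X ω) : b = s * a := by
  have hij : (⟨0, by omega⟩ : Fin d) ≠ ⟨1, by omega⟩ := by simp
  rw [← h.apply_single hij, ← h.apply_single_swap hij, ← integral_const_mul]
  congr 1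
  ext ω
  have := congrFun (congrFun (hX ω) ⟨0, by omega⟩) ⟨1, by omega⟩
  simp only [transpose_apply, Matrix.smul_apply, smul_eq_mul] at this
  simp only [trace_single_mul, this, smul_eq_mul]
  ring

variable [TopologicalSpace Ω]

variable (μ) [CompactSpace Ω] [OpensMeasurableSpace Ω] [IsFiniteMeasure μ]

lemma Continuous.integrable_of_compactSpace {f : Ω → ℂ} (hf : Continuous f) : Integrable f μ :=
  hf.integrable_of_hasCompactSupport (HasCompactSupport.of_compactSpace f)

/-- The second moment of a random matrix, as a bilinear form. -/
noncomputable def momentForm (X : Ω → Matrix (Fin d) (Fin d) ℂ) (hX : Continuous X) :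
    Matrix (Fin d) (Fin d) ℂ →ₗ[ℂ] Matrix (Fin d) (Fin d) ℂ →ₗ[ℂ] ℂ :=
  LinearMap.mk₂ ℂ (fun σ τ => ∫ ω, (σ * X ω).trace * (τ * X ω).trace ∂μ)
    (fun σ σ' τ => by
      simp only [add_mul, trace_add]
      exact integral_add
        (((continuous_trace_mul hX σ).mul (continuous_trace_mul hX τ)).integrable_of_compactSpace μ)
        (((continuous_trace_mul hX σ').mul
          (continuous_trace_mul hX τ)).integrable_of_compactSpace μ))
    (fun c σ τ => by
      simp only [smul_mul, trace_smul, smul_eq_mul, mul_assoc]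
      exact integral_const_mul _ _)
    (fun σ τ τ' => by
      simp only [add_mul, trace_add, mul_add]
      exact integral_add
        (((continuous_trace_mul hX σ).mul (continuous_trace_mul hX τ)).integrable_of_compactSpace μ)
        (((continuous_trace_mul hX σ).mul
          (continuous_trace_mul hX τ')).integrable_of_compactSpace μ))
    (fun c σ τ => by
      simp only [smul_mul, trace_smul, smul_eq_mul, mul_left_comm _ c]
      exact integral_const_mul _ _)

lemma momentForm_apply (X : Ω → Matrix (Fin d) (Fin d) ℂ) (hX : Continuous X)
    (σ τ : Matrix (Fin d) (Fin d) ℂ) :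
    momentForm μ X hX σ τ = ∫ ω, (σ * X ω).trace * (τ * X ω).trace ∂μ := rfl

variable {μ}

lemma IsMoment.coeff_trace_sq [IsProbabilityMeasure μ] (h : IsMoment μ X a b c)
    (hc : Continuous X) (hX : ∀ ω, (X ω * X ω).trace = d) :
    a * d ^ 2 + b * d + c * d = d := by
  have h1 : ∑ i, ∑ j, ∫ ω, (single i j (1 : ℂ) * X ω).trace * (single j i 1 * X ω).trace ∂μ =
      (d : ℂ) := by
    have : ∀ i j : Fin d, Integrable
        (fun ω => (single i j (1 : ℂ) * X ω).trace * (single j i 1 * X ω).trace) μ := fun i j =>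
      ((continuous_trace_mul hc _).mul (continuous_trace_mul hc _)).integrable_of_compactSpace μ
    simp_rw [← integral_finsetSum Finset.univ fun j _ => this _ j]
    rw [← integral_finsetSum Finset.univ fun i _ =>
      integrable_finsetSum Finset.univ fun j _ => this i j]
    have h2 : ∀ ω, ∑ i, ∑ j, (single i j (1 : ℂ) * X ω).trace * (single j i 1 * X ω).trace =
        (d : ℂ) := by
      intro ω
      rw [← hX ω, trace, Finset.sum_comm]
      simp [trace_single_mul, mul_apply]
    simp [h2]
  have h3 : ∀ i j, ∫ ω, (single i j (1 : ℂ) * X ω).trace * (single j i 1 * X ω).trace ∂μ =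
      a + b * (if i = j then 1 else 0) + c * (if i = j then 1 else 0) := by
    intro i j
    rw [h]
    by_cases hij : i = j
    · subst hij; simp
    · simp [hij, Ne.symm hij]
  simp only [h3] at h1
  simp [Finset.sum_add_distrib] at h1
  linear_combination h1

end Moments

section Haar

variable {d : ℕ} {G : Type*} [Group G]

/-- The conjugate of `N` by the inverse of a group element. -/
def conjBy (φ : G →* Matrix (Fin d) (Fin d) ℂ) (N : Matrix (Fin d) (Fin d) ℂ) (g : G) :
    Matrix (Fin d) (Fin d) ℂ := (φ g)ᴴ * N * φ g

variable {φ : G →* Matrix (Fin d) (Fin d) ℂ} {N : Matrix (Fin d) (Fin d) ℂ}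

lemma conjBy_transpose (hr : ∀ g, (φ g)ᴴ = (φ g)ᵀ) {s : ℂ} (hs : Nᵀ = s • N) (g : G) :
    (conjBy φ N g)ᵀ = s • conjBy φ N g := by
  simp [conjBy, hr, transpose_mul, hs, mul_assoc]

lemma continuous_conjBy [TopologicalSpace G] (hφ : Continuous φ) : Continuous (conjBy φ N) :=
  ((hφ.matrix_conjTranspose).matrix_mul continuous_const).matrix_mul hφ

lemma trace_conjBy (hu : ∀ g, φ g * (φ g)ᴴ = 1) (g : G) : (conjBy φ N g).trace = N.trace := by
  rw [conjBy, trace_mul_cycle, hu, one_mul]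

lemma conjBy_mul_conjBy (hu : ∀ g, φ g * (φ g)ᴴ = 1) (g : G) :
    conjBy φ N g * conjBy φ N g = conjBy φ (N * N) g := by
  simp only [conjBy, mul_assoc]
  rw [← mul_assoc (φ g) (φ g)ᴴ, hu, one_mul]

variable [TopologicalSpace G] [IsTopologicalGroup G] [CompactSpace G] [MeasurableSpace G]
  [BorelSpace G] (μ : Measure G) [μ.IsHaarMeasure] [IsProbabilityMeasure μ]

/-- A Haar probability measure on a compact group is right-invariant. -/
lemma isMulRightInvariant_of_compactSpace : μ.IsMulRightInvariant where
  map_mul_right_eq_self g := by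
    have : IsProbabilityMeasure (μ.map (· * g)) :=
      Measure.isProbabilityMeasure_map (measurable_mul_const g).aemeasurable
    have : (μ.map (· * g)).IsHaarMeasure := inferInstance
    exact Measure.isHaarMeasure_eq_of_isProbabilityMeasure _ _

lemma integral_conjBy_invariant (h : G) (σ τ : Matrix (Fin d) (Fin d) ℂ) :
    ∫ g, (φ h * σ * (φ h)ᴴ * conjBy φ N g).trace * (φ h * τ * (φ h)ᴴ * conjBy φ N g).trace ∂μ =
      ∫ g, (σ * conjBy φ N g).trace * (τ * conjBy φ N g).trace ∂μ := by
  have := isMulRightInvariant_of_compactSpace μ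
  rw [← integral_mul_right_eq_self (fun g => (σ * conjBy φ N g).trace * (τ * conjBy φ N g).trace) h]
  have key : ∀ (σ : Matrix (Fin d) (Fin d) ℂ) g, (φ h * σ * (φ h)ᴴ * conjBy φ N g).trace =
      (σ * conjBy φ N (g * h)).trace := by
    intro σ g
    rw [mul_assoc, mul_assoc, trace_mul_comm, conjBy, conjBy, map_mul, conjTranspose_mul]
    simp only [mul_assoc]
  simp only [key]

/-- The Haar second moment of a conjugated traceless matrix, when the group contains the real
orthogonal group. -/
lemma exists_isMoment_conjBy (hd : 2 ≤ d) (hφ : Continuous φ) (hu : ∀ g, φ g * (φ g)ᴴ = 1)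
    (ho : ∀ A : Matrix (Fin d) (Fin d) ℝ, A * Aᵀ = 1 → ∃ g, φ g = A.map Complex.ofReal)
    (hN : N.trace = 0) (hN2 : (N * N).trace = d) :
    ∃ a b c, IsMoment μ (conjBy φ N) a b c ∧ a + b + c * d = 0 ∧
      a * d ^ 2 + b * d + c * d = d := by
  have hB : OrthInvariant (momentForm μ (conjBy φ N) (continuous_conjBy hφ)) := by
    intro A hA σ τ
    obtain ⟨h, hh⟩ := ho A hA
    have ht : (A.map Complex.ofReal)ᵀ = (φ h)ᴴ := by
      rw [hh]; ext i j; simp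
    rw [ht, ← hh, momentForm_apply, momentForm_apply, integral_conjBy_invariant]
  obtain ⟨a, b, c, h⟩ := hB.exists_eq hd
  have h' : IsMoment μ (conjBy φ N) a b c := h
  exact ⟨a, b, c, h', h'.coeff_trace hd fun g => (trace_conjBy hu g).trans hN,
    h'.coeff_trace_sq (continuous_conjBy hφ) fun g => by
      rw [conjBy_mul_conjBy hu, trace_conjBy hu, hN2]⟩

/-- The moment of a traceless observable under a group containing a phase rotation. -/
lemma isMoment_conjBy_of_phase (hd : 2 ≤ d) (hφ : Continuous φ) (hu : ∀ g, φ g * (φ g)ᴴ = 1)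
    (ho : ∀ A : Matrix (Fin d) (Fin d) ℝ, A * Aᵀ = 1 → ∃ g, φ g = A.map Complex.ofReal)
    (hp : ∀ i, ∃ g, φ g = diagonal (Function.update 1 i Complex.I))
    (hN : N.trace = 0) (hN2 : (N * N).trace = d) :
    IsMoment μ (conjBy φ N) (d / (d ^ 2 - 1)) 0 (-1 / (d ^ 2 - 1)) := by
  obtain ⟨a, b, c, h, h1, h2⟩ := exists_isMoment_conjBy μ hd hφ hu ho hN hN2
  have hij : (⟨0, by omega⟩ : Fin d) ≠ ⟨1, by omega⟩ := by simp
  have hb : b = 0 := by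
    obtain ⟨g, hg⟩ := hp ⟨0, by omega⟩
    have h3 := integral_conjBy_invariant (φ := φ) (N := N) μ g
      (single ⟨0, by omega⟩ ⟨1, by omega⟩ 1) (single ⟨0, by omega⟩ ⟨1, by omega⟩ 1)
    have h4 : φ g * single ⟨0, by omega⟩ ⟨1, by omega⟩ 1 * (φ g)ᴴ =
        Complex.I • single ⟨0, by omega⟩ ⟨1, by omega⟩ 1 := by
      rw [hg]
      ext i j
      simp only [diagonal_conjTranspose, single_apply, diagonal_mul, mul_diagonal,
        Matrix.smul_apply, smul_eq_mul, mul_ite, mul_one, mul_zero, ite_mul, zero_mul]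
      refine ite_congr rfl ?_ fun _ => rfl
      rintro ⟨rfl, rfl⟩
      simp
    simp only [h4, smul_mul, trace_smul, smul_eq_mul] at h3
    rw [h.apply_single hij] at h3
    have h5 := h.apply_single hij
    simp_rw [mul_mul_mul_comm Complex.I, Complex.I_mul_I] at h3
    rw [integral_const_mul, h5] at h3
    linear_combination (-1 / 2) * h3
  have hd0 : (d : ℂ) ≠ 0 := by norm_cast; omega
  have hd1 : (d : ℂ) ^ 2 - 1 ≠ 0 := by
    rw [sub_ne_zero]; norm_cast; nlinarith
  subst hb
  convert h using 1
  · field_simp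
    linear_combination h1 - h2
  · field_simp
    refine mul_left_cancel₀ hd0 ?_
    linear_combination h2 - (d : ℂ) ^ 2 * h1

/-- The moment of a traceless real observable. -/
lemma isMoment_conjBy_of_symm (hd : 2 ≤ d) (hφ : Continuous φ) (hu : ∀ g, φ g * (φ g)ᴴ = 1)
    (ho : ∀ A : Matrix (Fin d) (Fin d) ℝ, A * Aᵀ = 1 → ∃ g, φ g = A.map Complex.ofReal)
    (hr : ∀ g, (φ g)ᴴ = (φ g)ᵀ) (hs : Nᵀ = N) (hN : N.trace = 0) (hN2 : (N * N).trace = d) :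
    IsMoment μ (conjBy φ N) (d / ((d - 1) * (d + 2))) (d / ((d - 1) * (d + 2)))
      (-2 / ((d - 1) * (d + 2))) := by
  obtain ⟨a, b, c, h, h1, h2⟩ := exists_isMoment_conjBy μ hd hφ hu ho hN hN2
  have hb := h.coeff_transpose hd 1 (conjBy_transpose hr (hs.trans (one_smul _ _).symm))
  rw [one_mul] at hb
  subst hb
  have hd0 : (d : ℂ) ≠ 0 := by norm_cast; omega
  have hd1 : (d : ℂ) - 1 ≠ 0 := by rw [sub_ne_zero]; norm_cast; omega
  have hd2 : (d : ℂ) + 2 ≠ 0 := by norm_cast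
  convert h using 1
  · field_simp
    linear_combination h1 - h2
  · field_simp
    linear_combination h1 - h2
  · field_simp
    refine mul_left_cancel₀ hd0 ?_
    linear_combination 2 * h2 - ((d : ℂ) ^ 2 + d) * h1

/-- The moment of an imaginary observable. -/
lemma isMoment_conjBy_of_skew (hd : 2 ≤ d) (hφ : Continuous φ) (hu : ∀ g, φ g * (φ g)ᴴ = 1)
    (ho : ∀ A : Matrix (Fin d) (Fin d) ℝ, A * Aᵀ = 1 → ∃ g, φ g = A.map Complex.ofReal)
    (hr : ∀ g, (φ g)ᴴ = (φ g)ᵀ) (hs : Nᵀ = -N) (hN2 : (N * N).trace = d) :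
    IsMoment μ (conjBy φ N) (1 / (d - 1)) (-1 / (d - 1)) 0 := by
  have hN : N.trace = 0 := by
    have := congrArg trace hs
    rw [trace_transpose, trace_neg] at this
    linear_combination (1 / 2) * this
  obtain ⟨a, b, c, h, h1, h2⟩ := exists_isMoment_conjBy μ hd hφ hu ho hN hN2
  have hb := h.coeff_transpose hd (-1) (conjBy_transpose hr (by simp [hs]))
  subst hb
  have hd0 : (d : ℂ) ≠ 0 := by norm_cast; omega
  have hd1 : (d : ℂ) - 1 ≠ 0 := by rw [sub_ne_zero]; norm_cast; omega
  have hc : c = 0 := mul_right_cancel₀ hd0 (by linear_combination h1)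
  subst hc
  have ha : 1 / ((d : ℂ) - 1) = a := by
    field_simp
    refine mul_left_cancel₀ hd0 ?_
    linear_combination -h2
  convert h using 1
  rw [← ha]
  ring

end Haar

section Bipartite

variable {d : ℕ}

/-- The block of `ρ` at fixed indices of the second factor. -/
def block (ρ : Matrix (Fin d × Fin d) (Fin d × Fin d) ℂ) (k k' : Fin d) :
    Matrix (Fin d) (Fin d) ℂ := Matrix.of fun j j' => ρ (j, k) (j', k')

lemma trace_mul_kronecker (ρ : Matrix (Fin d × Fin d) (Fin d × Fin d) ℂ)
    (X Y : Matrix (Fin d) (Fin d) ℂ) : (ρ * (X ⊗ₖ Y)).trace =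
      ((Matrix.of fun k k' => (block ρ k k' * X).trace) * Y).trace := by
  simp only [trace, diag_apply, mul_apply, block, of_apply, kroneckerMap_apply,
    Fintype.sum_prod_type, Finset.sum_mul, mul_assoc]
  rw [Finset.sum_comm]
  refine Finset.sum_congr rfl fun k _ => ?_
  rw [Finset.sum_comm_cycle]

lemma sum_block (ρ : Matrix (Fin d × Fin d) (Fin d × Fin d) ℂ) :
    ∑ k, block ρ k k = redA ρ := by
  ext i j
  simp [block, redA, Matrix.sum_apply]

lemma trace_block (ρ : Matrix (Fin d × Fin d) (Fin d × Fin d) ℂ) (k k' : Fin d) :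
    (block ρ k k').trace = redB ρ k k' := by
  simp [block, redB, trace]

lemma sum_trace_block_mul_block (ρ ρ' : Matrix (Fin d × Fin d) (Fin d × Fin d) ℂ) :
    ∑ k, ∑ k', (block ρ k k' * block ρ' k' k).trace = (ρ * ρ').trace := by
  simp only [trace, diag_apply, mul_apply, block, of_apply, Fintype.sum_prod_type]
  conv_rhs => rw [Finset.sum_comm]
  refine Finset.sum_congr rfl fun k _ => ?_
  rw [Finset.sum_comm]
  refine Finset.sum_congr rfl fun j _ => ?_
  rw [Finset.sum_comm]

lemma block_transpose (ρ : Matrix (Fin d × Fin d) (Fin d × Fin d) ℂ) (k k' : Fin d) :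
    (block ρ k k')ᵀ = block ρᵀ k' k := rfl

variable {Ω Ω' : Type*} [TopologicalSpace Ω] [CompactSpace Ω] [MeasurableSpace Ω]
  [OpensMeasurableSpace Ω] {μ : Measure Ω} [IsFiniteMeasure μ] [MeasurableSpace Ω']
  {ν : Measure Ω'} {X : Ω → Matrix (Fin d) (Fin d) ℂ} {Y : Ω' → Matrix (Fin d) (Fin d) ℂ}
  {a b c a' b' c' : ℂ}

/-- The second moment of a pair of independent random matrices with isotropic second moments. -/
lemma IsMoment.integral_integral (hX : Continuous X) (h : IsMoment μ X a b c)
    (h' : IsMoment ν Y a' b' c') (ρ : Matrix (Fin d × Fin d) (Fin d × Fin d) ℂ) :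
    ∫ ω, ∫ ω', (ρ * (X ω ⊗ₖ Y ω')).trace ^ 2 ∂ν ∂μ =
      a * a' * (ρ * ρ).trace + b * b' * (ρ * ρᵀ).trace +
      c * a' * (redB ρ * redB ρ).trace + c * b' * (redB ρ * (redB ρ)ᵀ).trace +
      a * c' * (redA ρ * redA ρ).trace + b * c' * (redA ρ * (redA ρ)ᵀ).trace +
      b * a' * ∑ k, ∑ k', (block ρ k k' * (block ρ k' k)ᵀ).trace +
      a * b' * ∑ k, ∑ k', (block ρ k k' * block ρ k k').trace +
      c * c' * (redA ρ).trace ^ 2 := by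
  simp only [trace_mul_kronecker, sq]
  have hinner := fun ω => h' (Matrix.of fun k k' => (block ρ k k' * X ω).trace)
    (Matrix.of fun k k' => (block ρ k k' * X ω).trace)
  simp only [hinner]
  have hI : ∀ σ τ : Matrix (Fin d) (Fin d) ℂ,
      Integrable (fun ω => (σ * X ω).trace * (τ * X ω).trace) μ := fun σ τ =>
    ((continuous_trace_mul hX σ).mul (continuous_trace_mul hX τ)).integrable_of_compactSpace μ
  have htr : ∀ ω, (Matrix.of fun k k' => (block ρ k k' * X ω).trace).trace =
      (redA ρ * X ω).trace := fun ω => by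
    rw [← sum_block, Finset.sum_mul, trace_sum]
    simp [trace]
  have h1 : ∀ ω, ((Matrix.of fun k k' => (block ρ k k' * X ω).trace) *
      (Matrix.of fun k k' => (block ρ k k' * X ω).trace)).trace =
      ∑ k, ∑ k', (block ρ k k' * X ω).trace * (block ρ k' k * X ω).trace := fun ω => by
    simp only [trace, diag_apply, mul_apply, of_apply]
  have h2 : ∀ ω, ((Matrix.of fun k k' => (block ρ k k' * X ω).trace) *
      (Matrix.of fun k k' => (block ρ k k' * X ω).trace)ᵀ).trace =
      ∑ k, ∑ k', (block ρ k k' * X ω).trace * (block ρ k k' * X ω).trace := fun ω => by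
    simp only [trace, diag_apply, mul_apply, of_apply, transpose_apply]
  simp only [htr, h1, h2]
  have hI1 := integrable_finsetSum Finset.univ fun k _ => integrable_finsetSum Finset.univ
    fun k' _ => hI (block ρ k k') (block ρ k' k)
  have hI2 := integrable_finsetSum Finset.univ fun k _ => integrable_finsetSum Finset.univ
    fun k' _ => hI (block ρ k k') (block ρ k k')
  have hI12 : Integrable (fun ω =>
      a' * (∑ k, ∑ k', (block ρ k k' * X ω).trace * (block ρ k' k * X ω).trace) +
      b' * ∑ k, ∑ k', (block ρ k k' * X ω).trace * (block ρ k k' * X ω).trace) μ :=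
    (hI1.const_mul a').add (hI2.const_mul b')
  rw [integral_add hI12 ((hI _ _).const_mul c'),
    integral_add (hI1.const_mul a') (hI2.const_mul b'), integral_const_mul, integral_const_mul,
    integral_const_mul, h,
    integral_finsetSum _ fun k _ => integrable_finsetSum _ fun k' _ => hI _ _,
    integral_finsetSum _ fun k _ => integrable_finsetSum _ fun k' _ => hI _ _]
  simp only [integral_finsetSum Finset.univ fun k' _ => hI (block ρ _ k') (block ρ k' _),
    integral_finsetSum Finset.univ fun k' _ => hI (block ρ _ k') (block ρ _ k'), h _ _]
  have hB1 : (redB ρ * redB ρ).trace =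
      ∑ k, ∑ k', (block ρ k k').trace * (block ρ k' k).trace := by
    simp only [trace_block]
    simp only [trace, diag_apply, mul_apply]
  have hB2 : (redB ρ * (redB ρ)ᵀ).trace =
      ∑ k, ∑ k', (block ρ k k').trace * (block ρ k k').trace := by
    simp only [trace_block]
    simp only [trace, diag_apply, mul_apply, transpose_apply]
  have hT : ∑ k, ∑ k', (block ρ k k' * (block ρ k k')ᵀ).trace = (ρ * ρᵀ).trace := by
    simp only [block_transpose, sum_trace_block_mul_block]
  rw [hB1, hB2, ← hT, ← sum_trace_block_mul_block ρ ρ]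
  simp only [Finset.sum_add_distrib, ← Finset.mul_sum]
  ring

end Bipartite

section Hermitian

variable {n : Type*} [Fintype n]

/-- A Hermitian matrix is symmetric exactly when `tr (H * H) = tr (H * Hᵀ)`. -/
lemma Matrix.IsHermitian.transpose_eq_iff {H : Matrix n n ℂ} (hH : H.IsHermitian) :
    Hᵀ = H ↔ (H * H).trace = (H * Hᵀ).trace := by
  refine ⟨fun h => by rw [h], fun h => ?_⟩
  have hs : (H - Hᵀ)ᴴ = H - Hᵀ := by
    rw [conjTranspose_sub, hH.eq, hH.transpose.eq]
  have h0 : ((H - Hᵀ) * (H - Hᵀ)ᴴ).trace = 0 := by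
    rw [hs, sub_mul, mul_sub, mul_sub, trace_sub, trace_sub, trace_sub, trace_mul_comm Hᵀ H,
      ← transpose_mul, trace_transpose, h]
    ring
  open scoped ComplexOrder in
  exact (sub_eq_zero.mp (trace_mul_conjTranspose_self_eq_zero_iff.mp h0)).symm

lemma Matrix.IsHermitian.ofReal_re_trace_mul {H K : Matrix n n ℂ} (hH : H.IsHermitian)
    (hK : K.IsHermitian) : (((H * K).trace.re : ℝ) : ℂ) = (H * K).trace := by
  rw [← Complex.conj_eq_iff_re]
  change star _ = _
  rw [← trace_conjTranspose, conjTranspose_mul, hH.eq, hK.eq, trace_mul_comm]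

end Hermitian

section Groups

/-- The unitary group of a finite-dimensional space is compact. -/
lemma compactSpace_unitaryGroup (𝕜 : Type*) [RCLike 𝕜] (d : ℕ) :
    CompactSpace (Matrix.unitaryGroup (Fin d) 𝕜) := by
  have h : IsClosed (Matrix.unitaryGroup (Fin d) 𝕜 : Set (Matrix (Fin d) (Fin d) 𝕜)) := by
    have : (Matrix.unitaryGroup (Fin d) 𝕜 : Set (Matrix (Fin d) (Fin d) 𝕜)) =
        {A | A * star A = 1} := by
      ext A
      exact mem_unitaryGroup_iff
    rw [this]
    exact isClosed_eq (continuous_id.mul continuous_star) continuous_const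
  refine isCompact_iff_compactSpace.mp (IsCompact.of_isClosed_subset (isCompact_univ_pi fun i : Fin d =>
    isCompact_univ_pi fun j : Fin d => isCompact_closedBall (0 : 𝕜) 1) h ?_)
  intro A hA i _ j _
  simpa using entry_norm_bound_of_unitary hA i j

variable {d : ℕ}

/-- The complexification of the orthogonal group, as a monoid homomorphism. -/
noncomputable def OCHom : Matrix.orthogonalGroup (Fin d) ℝ →* Matrix (Fin d) (Fin d) ℂ :=
  (Complex.ofRealHom.mapMatrix : Matrix (Fin d) (Fin d) ℝ →+* _).toMonoidHom.comp
    (Matrix.orthogonalGroup (Fin d) ℝ).subtype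

lemma OCHom_apply (O : Matrix.orthogonalGroup (Fin d) ℝ) : OCHom O = OC O := rfl

lemma continuous_OCHom : Continuous (OCHom (d := d)) :=
  (continuous_subtype_val).matrix_map Complex.continuous_ofReal

lemma conjTranspose_OCHom (O : Matrix.orthogonalGroup (Fin d) ℝ) : (OCHom O)ᴴ = (OCHom O)ᵀ := by
  rw [OCHom_apply]
  ext i j
  simp [OC]

lemma OCHom_mul_conjTranspose (O : Matrix.orthogonalGroup (Fin d) ℝ) :
    OCHom O * (OCHom O)ᴴ = 1 := by
  have h : (O : Matrix (Fin d) (Fin d) ℝ) * star (O : Matrix (Fin d) (Fin d) ℝ) = 1 :=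
    mem_unitaryGroup_iff.mp O.2
  have h2 : (OCHom O)ᴴ = (star (O : Matrix (Fin d) (Fin d) ℝ)).map Complex.ofReal := by
    rw [conjTranspose_OCHom]; rfl
  rw [h2]
  change (Complex.ofRealHom.mapMatrix (O : Matrix (Fin d) (Fin d) ℝ)) *
    Complex.ofRealHom.mapMatrix (star (O : Matrix (Fin d) (Fin d) ℝ)) = 1
  rw [← map_mul, h, map_one]

lemma exists_OCHom_eq (A : Matrix (Fin d) (Fin d) ℝ) (hA : A * Aᵀ = 1) :
    ∃ O, OCHom O = A.map Complex.ofReal :=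
  ⟨⟨A, mem_unitaryGroup_iff.mpr hA⟩, rfl⟩

lemma exists_unitary_eq (A : Matrix (Fin d) (Fin d) ℝ) (hA : A * Aᵀ = 1) :
    ∃ U, (Matrix.unitaryGroup (Fin d) ℂ).subtype U = A.map Complex.ofReal := by
  obtain ⟨O, hO⟩ := exists_OCHom_eq A hA
  refine ⟨⟨A.map Complex.ofReal, mem_unitaryGroup_iff.mpr ?_⟩, rfl⟩
  rw [← hO]
  exact OCHom_mul_conjTranspose O

lemma exists_unitary_eq_phase (i : Fin d) :
    ∃ U, (Matrix.unitaryGroup (Fin d) ℂ).subtype U = diagonal (Function.update 1 i Complex.I) := by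
  refine ⟨⟨diagonal (Function.update 1 i Complex.I), mem_unitaryGroup_iff.mpr ?_⟩, rfl⟩
  rw [star_eq_conjTranspose, diagonal_conjTranspose, diagonal_mul_diagonal, ← diagonal_one]
  congr 1
  ext j
  by_cases h : j = i
  · subst h; simp
  · simp [h]

lemma isHermitian_conjBy {G : Type*} [Group G] {φ : G →* Matrix (Fin d) (Fin d) ℂ}
    {N : Matrix (Fin d) (Fin d) ℂ} (hN : N.IsHermitian) (g : G) : (conjBy φ N g).IsHermitian :=
  isHermitian_conjTranspose_mul_mul _ hN

lemma trace_kronecker_conj (ρ : Matrix (Fin d × Fin d) (Fin d × Fin d) ℂ)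
    (U V U' V' M N : Matrix (Fin d) (Fin d) ℂ) :
    ((U ⊗ₖ V) * ρ * (U' ⊗ₖ V') * (M ⊗ₖ N)).trace =
      (ρ * ((U' * M * U) ⊗ₖ (V' * N * V))).trace := by
  rw [mul_assoc, mul_assoc, trace_mul_comm, mul_kronecker_mul, mul_kronecker_mul]
  simp only [mul_assoc]

lemma redA_isHermitian {ρ : Matrix (Fin d × Fin d) (Fin d × Fin d) ℂ} (hρ : ρ.IsHermitian) :
    (redA ρ).IsHermitian := by
  ext i j
  change star (∑ k, ρ (j, k) (i, k)) = ∑ k, ρ (i, k) (j, k)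
  rw [star_sum]
  exact Finset.sum_congr rfl fun k _ => hρ.apply _ _

lemma redB_isHermitian {ρ : Matrix (Fin d × Fin d) (Fin d × Fin d) ℂ} (hρ : ρ.IsHermitian) :
    (redB ρ).IsHermitian := by
  ext i j
  change star (∑ k, ρ (k, j) (k, i)) = ∑ k, ρ (k, i) (k, j)
  rw [star_sum]
  exact Finset.sum_congr rfl fun k _ => hρ.apply _ _

lemma redA_transpose (ρ : Matrix (Fin d × Fin d) (Fin d × Fin d) ℂ) :
    (redA ρ)ᵀ = redA ρᵀ := rfl

lemma redB_transpose (ρ : Matrix (Fin d × Fin d) (Fin d × Fin d) ℂ) :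
    (redB ρ)ᵀ = redB ρᵀ := rfl

/-- The real double moment agrees with its complex version. -/
lemma ofReal_integral_integral_conjBy {G : Type*} [Group G] [MeasurableSpace G] (μ : Measure G)
    {φ : G →* Matrix (Fin d) (Fin d) ℂ} {M N : Matrix (Fin d) (Fin d) ℂ} (hM : M.IsHermitian)
    (hN : N.IsHermitian) {ρ : Matrix (Fin d × Fin d) (Fin d × Fin d) ℂ} (hρ : ρ.IsHermitian) :
    ((∫ g, ∫ h, (ρ * (conjBy φ M g ⊗ₖ conjBy φ N h)).trace.re ^ 2 ∂μ ∂μ : ℝ) : ℂ) =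
      ∫ g, ∫ h, (ρ * (conjBy φ M g ⊗ₖ conjBy φ N h)).trace ^ 2 ∂μ ∂μ := by
  have key : ∀ g h, (ρ * (conjBy φ M g ⊗ₖ conjBy φ N h)).trace =
      (((ρ * (conjBy φ M g ⊗ₖ conjBy φ N h)).trace.re : ℝ) : ℂ) := fun g h =>
    (hρ.ofReal_re_trace_mul (by
      rw [IsHermitian, conjTranspose_kronecker, (isHermitian_conjBy hM g).eq,
        (isHermitian_conjBy hN h).eq])).symm
  rw [← integral_complex_ofReal]
  congr 1
  ext g
  rw [← integral_complex_ofReal]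
  congr 1
  ext h
  rw [key g h, Complex.ofReal_pow, Complex.ofReal_re]

/-- The marginal moment of an imaginary observable. -/
lemma ofReal_integral_skew (hd : 2 ≤ d) [MeasurableSpace (Matrix.orthogonalGroup (Fin d) ℝ)]
    [BorelSpace (Matrix.orthogonalGroup (Fin d) ℝ)]
    (μ : Measure (Matrix.orthogonalGroup (Fin d) ℝ)) [μ.IsHaarMeasure] [IsProbabilityMeasure μ]
    {σ M : Matrix (Fin d) (Fin d) ℂ} (hσ : σ.IsHermitian) (hM : M.IsHermitian) (hs : Mᵀ = -M)
    (hM2 : (M * M).trace = d) :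
    ((∫ O, (OC O * σ * (OC O)ᵀ * M).trace.re ^ 2 ∂μ : ℝ) : ℂ) =
      1 / (d - 1) * ((σ * σ).trace - (σ * σᵀ).trace) := by
  have := compactSpace_unitaryGroup ℝ d
  have h := isMoment_conjBy_of_skew μ hd continuous_OCHom OCHom_mul_conjTranspose exists_OCHom_eq
    conjTranspose_OCHom hs hM2 σ σ
  rw [← integral_complex_ofReal]
  trans ∫ O, (σ * conjBy OCHom M O).trace * (σ * conjBy OCHom M O).trace ∂μ
  · congr 1
    ext O
    have : (OC O * σ * (OC O)ᵀ * M).trace = (σ * conjBy OCHom M O).trace := by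
      rw [mul_assoc, mul_assoc, trace_mul_comm, conjBy, conjTranspose_OCHom, OCHom_apply]
      simp only [mul_assoc]
    rw [this, Complex.ofReal_pow, hσ.ofReal_re_trace_mul (isHermitian_conjBy hM O), sq]
  · rw [h]
    ring

end Groups

/-- a two-qudit state is real iff both marginal PRRM moments vanish and the
unitary moment equals the combination of the orthogonal moments. -/
theorem stmt_9 (d : ℕ) (hd : 2 ≤ d)
    [MeasurableSpace (Matrix.orthogonalGroup (Fin d) ℝ)]
    [BorelSpace (Matrix.orthogonalGroup (Fin d) ℝ)]
    (μO : Measure (Matrix.orthogonalGroup (Fin d) ℝ))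
    [μO.IsHaarMeasure] [IsProbabilityMeasure μO]
    [MeasurableSpace (Matrix.unitaryGroup (Fin d) ℂ)]
    [BorelSpace (Matrix.unitaryGroup (Fin d) ℂ)]
    (μU : Measure (Matrix.unitaryGroup (Fin d) ℂ))
    [μU.IsHaarMeasure] [IsProbabilityMeasure μU]
    (ρ : Matrix (Fin d × Fin d) (Fin d × Fin d) ℂ) (hρ : ρ.IsHermitian) (hρtr : ρ.trace = 1)
    (NA NB : Matrix (Fin d) (Fin d) ℂ) (hNA : NA.IsHermitian) (hNB : NB.IsHermitian)
    (hNAtr : NA.trace = 0) (hNBtr : NB.trace = 0)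
    (hNA2 : (NA * NA).trace = (d : ℂ)) (hNB2 : (NB * NB).trace = (d : ℂ))
    (MA MB : Matrix (Fin d) (Fin d) ℂ) (hMA : MA.IsHermitian) (hMB : MB.IsHermitian)
    (hMAreal : MAᵀ = MA) (hMBreal : MBᵀ = MB)
    (hMAtr : MA.trace = 0) (hMBtr : MB.trace = 0)
    (hMA2 : (MA * MA).trace = (d : ℂ)) (hMB2 : (MB * MB).trace = (d : ℂ))
    (MhA MhB : Matrix (Fin d) (Fin d) ℂ) (hMhA : MhA.IsHermitian) (hMhB : MhB.IsHermitian)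
    (hMhAimag : MhAᵀ = -MhA) (hMhBimag : MhBᵀ = -MhB)
    (hMhA2 : (MhA * MhA).trace = (d : ℂ)) (hMhB2 : (MhB * MhB).trace = (d : ℂ))
    (R Q Qh QhA QhB : ℝ)
    (hR : R = ∫ UA, ∫ UB,
      ((((UA : Matrix (Fin d) (Fin d) ℂ) ⊗ₖ (UB : Matrix (Fin d) (Fin d) ℂ)) * ρ *
        ((UA : Matrix (Fin d) (Fin d) ℂ) ⊗ₖ (UB : Matrix (Fin d) (Fin d) ℂ))ᴴ *
        (NA ⊗ₖ NB)).trace.re) ^ 2 ∂μU ∂μU)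
    (hQ : Q = ∫ OA, ∫ OB,
      (((OC OA ⊗ₖ OC OB) * ρ * ((OC OA)ᵀ ⊗ₖ (OC OB)ᵀ) * (MA ⊗ₖ MB)).trace.re) ^ 2 ∂μO ∂μO)
    (hQh : Qh = ∫ OA, ∫ OB,
      (((OC OA ⊗ₖ OC OB) * ρ * ((OC OA)ᵀ ⊗ₖ (OC OB)ᵀ) * (MhA ⊗ₖ MhB)).trace.re) ^ 2 ∂μO ∂μO)
    (hQhA : QhA = ∫ O, ((OC O * redA ρ * (OC O)ᵀ * MhA).trace.re) ^ 2 ∂μO)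
    (hQhB : QhB = ∫ O, ((OC O * redB ρ * (OC O)ᵀ * MhB).trace.re) ^ 2 ∂μO) :
    ρᵀ = ρ ↔
      QhA = 0 ∧ QhB = 0 ∧
        ((d : ℝ) ^ 2 - 1) ^ 2 * R =
          (((d : ℝ) - 1) * ((d : ℝ) + 2) / 2) ^ 2 * Q +
            ((d : ℝ) * ((d : ℝ) - 1) / 2) ^ 2 * Qh := by
  have := compactSpace_unitaryGroup ℝ d
  have := compactSpace_unitaryGroup ℂ d
  have hu : ∀ U, (Matrix.unitaryGroup (Fin d) ℂ).subtype U *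
      ((Matrix.unitaryGroup (Fin d) ℂ).subtype U)ᴴ = 1 := fun U => mem_unitaryGroup_iff.mp U.2
  have hc : Continuous (Matrix.unitaryGroup (Fin d) ℂ).subtype := continuous_subtype_val
  have hRc : (R : ℂ) = ∫ g, ∫ h, (ρ * (conjBy (Matrix.unitaryGroup (Fin d) ℂ).subtype NA g ⊗ₖ
      conjBy (Matrix.unitaryGroup (Fin d) ℂ).subtype NB h)).trace ^ 2 ∂μU ∂μU := by
    rw [← ofReal_integral_integral_conjBy μU hNA hNB hρ, hR]
    simp only [conjTranspose_kronecker, trace_kronecker_conj]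
    rfl
  have hQc : (Q : ℂ) = ∫ g, ∫ h, (ρ * (conjBy OCHom MA g ⊗ₖ conjBy OCHom MB h)).trace ^ 2
      ∂μO ∂μO := by
    rw [← ofReal_integral_integral_conjBy μO hMA hMB hρ, hQ]
    simp only [trace_kronecker_conj, conjBy, conjTranspose_OCHom]
    rfl
  have hQhc : (Qh : ℂ) = ∫ g, ∫ h, (ρ * (conjBy OCHom MhA g ⊗ₖ conjBy OCHom MhB h)).trace ^ 2
      ∂μO ∂μO := by
    rw [← ofReal_integral_integral_conjBy μO hMhA hMhB hρ, hQh]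
    simp only [trace_kronecker_conj, conjBy, conjTranspose_OCHom]
    rfl
  rw [IsMoment.integral_integral (continuous_conjBy hc)
    (isMoment_conjBy_of_phase μU hd hc hu exists_unitary_eq exists_unitary_eq_phase hNAtr hNA2)
    (isMoment_conjBy_of_phase μU hd hc hu exists_unitary_eq exists_unitary_eq_phase hNBtr hNB2)]
    at hRc
  rw [IsMoment.integral_integral (continuous_conjBy continuous_OCHom)
    (isMoment_conjBy_of_symm μO hd continuous_OCHom OCHom_mul_conjTranspose exists_OCHom_eq
      conjTranspose_OCHom hMAreal hMAtr hMA2)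
    (isMoment_conjBy_of_symm μO hd continuous_OCHom OCHom_mul_conjTranspose exists_OCHom_eq
      conjTranspose_OCHom hMBreal hMBtr hMB2)] at hQc
  rw [IsMoment.integral_integral (continuous_conjBy continuous_OCHom)
    (isMoment_conjBy_of_skew μO hd continuous_OCHom OCHom_mul_conjTranspose exists_OCHom_eq
      conjTranspose_OCHom hMhAimag hMhA2)
    (isMoment_conjBy_of_skew μO hd continuous_OCHom OCHom_mul_conjTranspose exists_OCHom_eq
      conjTranspose_OCHom hMhBimag hMhB2)] at hQhc
  have hA : (QhA : ℂ) = _ := hQhA ▸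
    ofReal_integral_skew hd μO (redA_isHermitian hρ) hMhA hMhAimag hMhA2
  have hB : (QhB : ℂ) = _ := hQhB ▸
    ofReal_integral_skew hd μO (redB_isHermitian hρ) hMhB hMhBimag hMhB2
  have hd0 : (d : ℂ) ≠ 0 := by norm_cast; omega
  have hd1 : (d : ℂ) - 1 ≠ 0 := by rw [sub_ne_zero]; norm_cast; omega
  have hd2 : (d : ℂ) + 2 ≠ 0 := by norm_cast
  have hd3 : (d : ℂ) ^ 2 - 1 ≠ 0 := by rw [sub_ne_zero]; norm_cast; nlinarith
  have key : ((d : ℂ) ^ 2 - 1) ^ 2 * R - ((((d : ℂ) - 1) * (d + 2) / 2) ^ 2 * Q +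
      ((d : ℂ) * (d - 1) / 2) ^ 2 * Qh) =
      d ^ 2 / 2 * ((ρ * ρ).trace - (ρ * ρᵀ).trace) -
      d / 2 * ((redA ρ * redA ρ).trace - (redA ρ * (redA ρ)ᵀ).trace) -
      d / 2 * ((redB ρ * redB ρ).trace - (redB ρ * (redB ρ)ᵀ).trace) := by
    rw [hRc, hQc, hQhc]
    field_simp
    ring
  have hiff : ((d : ℝ) ^ 2 - 1) ^ 2 * R = (((d : ℝ) - 1) * ((d : ℝ) + 2) / 2) ^ 2 * Q +
      ((d : ℝ) * ((d : ℝ) - 1) / 2) ^ 2 * Qh ↔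
      ((d : ℂ) ^ 2 - 1) ^ 2 * R - ((((d : ℂ) - 1) * (d + 2) / 2) ^ 2 * Q +
      ((d : ℂ) * (d - 1) / 2) ^ 2 * Qh) = 0 := by
    rw [sub_eq_zero, ← Complex.ofReal_inj]
    push_cast
    rfl
  rw [hiff, key, ← Complex.ofReal_eq_zero (z := QhA), ← Complex.ofReal_eq_zero (z := QhB), hA, hB]
  constructor
  · intro h
    rw [redA_transpose, redB_transpose, h]
    simp
  · rintro ⟨h1, h2, h3⟩
    have h1' := (mul_eq_zero.mp h1).resolve_left (one_div_ne_zero hd1)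
    have h2' := (mul_eq_zero.mp h2).resolve_left (one_div_ne_zero hd1)
    rw [hρ.transpose_eq_iff, ← sub_eq_zero]
    refine mul_left_cancel₀ (pow_ne_zero 2 hd0) ?_
    rw [h1', h2'] at h3
    linear_combination 2 * h3
end

section
/- Let d ≥ 2, N ≥ 1, and let M be a real observable (Hermitian d×d with Mᵀ = M) satisfying tr(M) = 0 and tr(M²) = d. Let ρ be a fully separable N-qudit state: a complex matrix indexed by (Fin N → Fin d) of the form ρ = Σ_{i ∈ I} p_i · (⊗_{n} σ_{i,n}) for a finite index set I, where each p_i ≥ 0, Σ_i p_i = 1, and each σ_{i,n} is a positive semidefinite Hermitian d×d matrix with tr(σ_{i,n}) = 1. Then the second moment of real randomized measurements satisfies ∫ ⋯ ∫ ( tr( (⊗_n O_n) · ρ · (⊗_n O_nᵀ) · (⊗_n M) ) )² dμ_O(O₁) ⋯ dμ_O(O_N) ≤ (2/(d+2))^N. -/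
open MeasureTheory Matrix
open scoped ComplexOrder

/-- The `N`-fold Kronecker product of `d×d` matrices, indexed by `Fin N → Fin d`:
`(⊗_n X_n)_{f,g} = Π_n (X_n)_{f(n),g(n)}`. -/
noncomputable def ktensor {d N : ℕ} (X : Fin N → Matrix (Fin d) (Fin d) ℂ) :
    Matrix (Fin N → Fin d) (Fin N → Fin d) ℂ :=
  Matrix.of fun f g => ∏ n, X n (f n) (g n)

section OrthogonalMoments

variable {d : ℕ}

theorem compactSpace_orthogonalGroup : CompactSpace (orthogonalGroup (Fin d) ℝ) := by
  refine isCompact_iff_compactSpace.mp ?_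
  have hK : IsCompact (Set.pi Set.univ fun _ : Fin d => Set.pi Set.univ fun _ : Fin d =>
      Set.Icc (-1 : ℝ) 1) :=
    isCompact_univ_pi fun _ => isCompact_univ_pi fun _ => isCompact_Icc
  refine hK.of_isClosed_subset ?_ ?_
  · have : (orthogonalGroup (Fin d) ℝ : Set (Matrix (Fin d) (Fin d) ℝ)) =
        {A | A * Aᵀ = 1} := by
      ext A
      exact mem_orthogonalGroup_iff (Fin d) ℝ
    rw [this]
    exact isClosed_eq (by fun_prop) continuous_const
  · intro A hA i _ j _
    have := entry_norm_bound_of_unitary hA i j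
    rw [Real.norm_eq_abs, abs_le] at this
    exact this

theorem continuous_orthogonalGroup_mulVec (v : Fin d → ℝ) :
    Continuous fun O : orthogonalGroup (Fin d) ℝ => (O : Matrix (Fin d) (Fin d) ℝ) *ᵥ v :=
  Continuous.matrix_mulVec continuous_subtype_val continuous_const

theorem continuous_trace_conj (S M : Matrix (Fin d) (Fin d) ℝ) :
    Continuous fun O : orthogonalGroup (Fin d) ℝ =>
      ((O : Matrix (Fin d) (Fin d) ℝ) * S * (O : Matrix (Fin d) (Fin d) ℝ)ᵀ * M).trace := by
  have := continuous_subtype_val (p := (· ∈ orthogonalGroup (Fin d) ℝ))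
  exact (((this.matrix_mul continuous_const).matrix_mul this.matrix_transpose).matrix_mul
    continuous_const).matrix_trace

theorem integrable_orthogonalGroup_of_continuous
    [MeasurableSpace (orthogonalGroup (Fin d) ℝ)] [BorelSpace (orthogonalGroup (Fin d) ℝ)]
    (μ : Measure (orthogonalGroup (Fin d) ℝ)) [IsFiniteMeasure μ]
    {f : orthogonalGroup (Fin d) ℝ → ℝ} (hf : Continuous f) : Integrable f μ := by
  have := compactSpace_orthogonalGroup (d := d)
  exact hf.integrable_of_hasCompactSupport (HasCompactSupport.of_compactSpace f)

/-- The orthogonal group acts transitively on each sphere, via Householder reflections. -/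
theorem exists_orthogonalGroup_vecMul_eq {u w : Fin d → ℝ} (h : u ⬝ᵥ u = w ⬝ᵥ w) :
    ∃ U : orthogonalGroup (Fin d) ℝ, u ᵥ* (U : Matrix (Fin d) (Fin d) ℝ) = w := by
  by_cases hx : u - w = 0
  · exact ⟨1, by simpa using sub_eq_zero.mp hx⟩
  set x := u - w with hxdef
  have hxx : x ⬝ᵥ x ≠ 0 := by rwa [Ne, dotProduct_self_eq_zero]
  have hux : 2 * (u ⬝ᵥ x) = x ⬝ᵥ x := by
    simp only [hxdef, dotProduct_sub, sub_dotProduct, dotProduct_comm w u]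
    linarith
  refine ⟨⟨1 - (2 / (x ⬝ᵥ x)) • vecMulVec x x, ?_⟩, ?_⟩
  · rw [mem_orthogonalGroup_iff]
    simp only [transpose_sub, transpose_one, transpose_smul, transpose_vecMulVec, sub_mul, mul_sub,
      one_mul, mul_one, smul_mul_smul_comm, vecMulVec_mul_vecMulVec, vecMulVec_smul,
      smul_smul]
    ext i j
    simp only [Matrix.sub_apply, Matrix.smul_apply, vecMulVec_apply, smul_eq_mul]
    field_simp
    ring
  · simp only [vecMul_sub, vecMul_one, vecMul_smul, vecMul_vecMulVec, smul_smul]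
    have : 2 / (x ⬝ᵥ x) * (u ⬝ᵥ x) = 1 := by
      field_simp
      exact hux
    rw [this, one_smul, hxdef, sub_sub_cancel]

variable [MeasurableSpace (orthogonalGroup (Fin d) ℝ)] [BorelSpace (orthogonalGroup (Fin d) ℝ)]
  (μ : Measure (orthogonalGroup (Fin d) ℝ)) [μ.IsHaarMeasure]

theorem integral_dotProduct_mulVec_pow_four_congr (v : Fin d → ℝ) {u w : Fin d → ℝ}
    (h : u ⬝ᵥ u = w ⬝ᵥ w) :
    ∫ O, (u ⬝ᵥ (O : Matrix (Fin d) (Fin d) ℝ) *ᵥ v) ^ 4 ∂μ =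
      ∫ O, (w ⬝ᵥ (O : Matrix (Fin d) (Fin d) ℝ) *ᵥ v) ^ 4 ∂μ := by
  obtain ⟨U, rfl⟩ := exists_orthogonalGroup_vecMul_eq h
  rw [← integral_mul_left_eq_self _ U]
  simp [← dotProduct_mulVec]

theorem exists_integral_dotProduct_mulVec_pow_four (hd : 0 < d) (v : Fin d → ℝ) :
    ∃ A : ℝ, ∀ u : Fin d → ℝ,
      ∫ O, (u ⬝ᵥ (O : Matrix (Fin d) (Fin d) ℝ) *ᵥ v) ^ 4 ∂μ = A * (u ⬝ᵥ u) ^ 2 := by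
  let e : Fin d → ℝ := Pi.single ⟨0, hd⟩ 1
  refine ⟨∫ O, (e ⬝ᵥ (O : Matrix (Fin d) (Fin d) ℝ) *ᵥ v) ^ 4 ∂μ, fun u => ?_⟩
  have hnonneg : 0 ≤ u ⬝ᵥ u := dotProduct_self_star_nonneg u
  have hs : √(u ⬝ᵥ u) ^ 4 = (u ⬝ᵥ u) ^ 2 := by
    rw [show 4 = 2 * 2 from rfl, pow_mul, Real.sq_sqrt hnonneg]
  rw [integral_dotProduct_mulVec_pow_four_congr μ v (w := √(u ⬝ᵥ u) • e)
    (by simp [e, Real.mul_self_sqrt hnonneg])]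
  simp only [smul_dotProduct, smul_eq_mul, mul_pow, hs]
  rw [integral_const_mul, mul_comm]

/-- The fourth moments of `O v` for Haar-random orthogonal `O` and a unit vector `v`. -/
theorem integral_sq_dotProduct_mulVec_mul_sq [IsProbabilityMeasure μ] (hd : 0 < d) {v : Fin d → ℝ} (hv : v ⬝ᵥ v = 1)
    (u w : Fin d → ℝ) :
    ∫ O, (u ⬝ᵥ (O : Matrix (Fin d) (Fin d) ℝ) *ᵥ v) ^ 2 *
        (w ⬝ᵥ (O : Matrix (Fin d) (Fin d) ℝ) *ᵥ v) ^ 2 ∂μ =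
      ((u ⬝ᵥ u) * (w ⬝ᵥ w) + 2 * (u ⬝ᵥ w) ^ 2) / (d * (d + 2)) := by
  obtain ⟨A, hA⟩ := exists_integral_dotProduct_mulVec_pow_four μ hd v
  have hc := continuous_orthogonalGroup_mulVec v
  have hint4 (u : Fin d → ℝ) :
      Integrable (fun O : orthogonalGroup (Fin d) ℝ =>
        (u ⬝ᵥ (O : Matrix (Fin d) (Fin d) ℝ) *ᵥ v) ^ 4) μ :=
    integrable_orthogonalGroup_of_continuous μ ((continuous_const.dotProduct hc).pow 4)
  have hint22 (u w : Fin d → ℝ) :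
      Integrable (fun O : orthogonalGroup (Fin d) ℝ =>
        (u ⬝ᵥ (O : Matrix (Fin d) (Fin d) ℝ) *ᵥ v) ^ 2 *
        (w ⬝ᵥ (O : Matrix (Fin d) (Fin d) ℝ) *ᵥ v) ^ 2) μ :=
    integrable_orthogonalGroup_of_continuous μ
      (((continuous_const.dotProduct hc).pow 2).mul ((continuous_const.dotProduct hc).pow 2))
  have polar (u w : Fin d → ℝ) :
      ∫ O, (u ⬝ᵥ (O : Matrix (Fin d) (Fin d) ℝ) *ᵥ v) ^ 2 *
        (w ⬝ᵥ (O : Matrix (Fin d) (Fin d) ℝ) *ᵥ v) ^ 2 ∂μ =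
      A / 3 * ((u ⬝ᵥ u) * (w ⬝ᵥ w) + 2 * (u ⬝ᵥ w) ^ 2) := by
    have key (O : orthogonalGroup (Fin d) ℝ) :
        (u ⬝ᵥ (O : Matrix (Fin d) (Fin d) ℝ) *ᵥ v) ^ 2 *
          (w ⬝ᵥ (O : Matrix (Fin d) (Fin d) ℝ) *ᵥ v) ^ 2 =
        (1 / 12) * ((((u + w) ⬝ᵥ (O : Matrix (Fin d) (Fin d) ℝ) *ᵥ v) ^ 4 +
          ((u - w) ⬝ᵥ (O : Matrix (Fin d) (Fin d) ℝ) *ᵥ v) ^ 4) -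
          (2 * (u ⬝ᵥ (O : Matrix (Fin d) (Fin d) ℝ) *ᵥ v) ^ 4 +
          2 * (w ⬝ᵥ (O : Matrix (Fin d) (Fin d) ℝ) *ᵥ v) ^ 4)) := by
      rw [add_dotProduct, sub_dotProduct]
      ring
    have hadd : Integrable (fun O : orthogonalGroup (Fin d) ℝ =>
        ((u + w) ⬝ᵥ (O : Matrix (Fin d) (Fin d) ℝ) *ᵥ v) ^ 4 +
        ((u - w) ⬝ᵥ (O : Matrix (Fin d) (Fin d) ℝ) *ᵥ v) ^ 4) μ :=
      (hint4 (u + w)).add (hint4 (u - w))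
    have hadd' : Integrable (fun O : orthogonalGroup (Fin d) ℝ =>
        2 * (u ⬝ᵥ (O : Matrix (Fin d) (Fin d) ℝ) *ᵥ v) ^ 4 +
        2 * (w ⬝ᵥ (O : Matrix (Fin d) (Fin d) ℝ) *ᵥ v) ^ 4) μ :=
      ((hint4 u).const_mul 2).add ((hint4 w).const_mul 2)
    simp_rw [key]
    rw [integral_const_mul, integral_sub hadd hadd',
      integral_add (hint4 _) (hint4 _),
      integral_add ((hint4 _).const_mul 2) ((hint4 _).const_mul 2),
      integral_const_mul, integral_const_mul, hA, hA, hA, hA]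
    simp only [add_dotProduct, sub_dotProduct, dotProduct_add, dotProduct_sub, dotProduct_comm w u]
    ring
  have hnorm : A / 3 * (d * (d + 2)) = 1 := by
    have hO (O : orthogonalGroup (Fin d) ℝ) :
        ∑ a : Fin d, ∑ b : Fin d,
          (Pi.single a 1 ⬝ᵥ (O : Matrix (Fin d) (Fin d) ℝ) *ᵥ v) ^ 2 *
          (Pi.single b 1 ⬝ᵥ (O : Matrix (Fin d) (Fin d) ℝ) *ᵥ v) ^ 2 = (1 : ℝ) := by
      have h1 : ((O : Matrix (Fin d) (Fin d) ℝ) *ᵥ v) ⬝ᵥ ((O : Matrix (Fin d) (Fin d) ℝ) *ᵥ v)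
          = 1 := by
        have := (mem_orthogonalGroup_iff' (Fin d) ℝ).mp O.2
        rw [dotProduct_mulVec, vecMul_mulVec, ← dotProduct_mulVec, this, one_mulVec, hv]
      simp only [single_dotProduct, one_mul]
      rw [← Finset.sum_mul_sum]
      simp only [dotProduct, ← pow_two] at h1
      rw [h1, one_mul]
    have := integral_congr_ae (μ := μ) (Filter.Eventually.of_forall hO)
    rw [integral_finsetSum _ fun a _ => integrable_finsetSum _ fun b _ => hint22 _ _] at this
    simp_rw [integral_finsetSum _ fun b _ => hint22 _ _, polar] at this
    simp only [integral_const, probReal_univ, one_smul, single_dotProduct, one_mul, Pi.single_apply,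
      ← Finset.mul_sum, Finset.sum_add_distrib] at this
    simp at this
    linarith
  rw [polar]
  have hd' : (0 : ℝ) < d := by exact_mod_cast hd
  rw [eq_div_iff (by positivity)]
  linear_combination ((u ⬝ᵥ u) * (w ⬝ᵥ w) + 2 * (u ⬝ᵥ w) ^ 2) * hnorm

end OrthogonalMoments

/-- The spectral decomposition of a real symmetric matrix. -/
theorem Matrix.IsHermitian.exists_orthonormal_eigenvectors {d : ℕ} {S : Matrix (Fin d) (Fin d) ℝ}
    (hS : S.IsHermitian) :
    ∃ v : Fin d → Fin d → ℝ, (∀ j k, v j ⬝ᵥ v k = if j = k then 1 else 0) ∧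
      S = ∑ j, hS.eigenvalues j • vecMulVec (v j) (v j) := by
  refine ⟨fun j => (hS.eigenvectorUnitary : Matrix (Fin d) (Fin d) ℝ).col j, fun j k => ?_, ?_⟩
  · have h := (mem_orthogonalGroup_iff' (Fin d) ℝ).mp hS.eigenvectorUnitary.2
    have := congrFun (congrFun h j) k
    rwa [one_apply] at this
  · conv_lhs => rw [hS.spectral_theorem, Unitary.conjStarAlgAut_apply]
    ext a b
    rw [mul_apply, Matrix.sum_apply]
    simp only [mul_diagonal, Matrix.smul_apply, vecMulVec_apply, star_apply,
      star_trivial, Function.comp, RCLike.ofReal_real_eq_id, id, smul_eq_mul, col_apply]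
    exact Finset.sum_congr rfl fun j _ => by ring

theorem sq_sum_mul_le {ι : Type*} [Fintype ι] {p : ι → ℝ} (hp : ∀ i, 0 ≤ p i)
    (hsum : ∑ i, p i = 1) (x : ι → ℝ) : (∑ i, p i * x i) ^ 2 ≤ ∑ i, p i * x i ^ 2 := by
  simpa using (even_two.convexOn_pow (𝕜 := ℝ)).map_sum_le (t := Finset.univ) (w := p) (p := x)
    (fun i _ => hp i) hsum (fun _ _ => Set.mem_univ _)

section SecondMoment

variable {d : ℕ} [MeasurableSpace (orthogonalGroup (Fin d) ℝ)]
  [BorelSpace (orthogonalGroup (Fin d) ℝ)]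
  (μ : Measure (orthogonalGroup (Fin d) ℝ)) [μ.IsHaarMeasure] [IsProbabilityMeasure μ]

/-- The second moment of a quadratic form at a Haar-random unit vector. -/
theorem integral_sq_quadraticForm (hd : 0 < d) {M : Matrix (Fin d) (Fin d) ℝ}
    (hM : M.IsHermitian) {v : Fin d → ℝ} (hv : v ⬝ᵥ v = 1) :
    ∫ O, (((O : Matrix (Fin d) (Fin d) ℝ) *ᵥ v) ⬝ᵥ M *ᵥ ((O : Matrix (Fin d) (Fin d) ℝ) *ᵥ v)) ^ 2
        ∂μ = (M.trace ^ 2 + 2 * (M * M).trace) / (d * (d + 2)) := by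
  obtain ⟨u, hu, hMu⟩ := hM.exists_orthonormal_eigenvectors
  set l := hM.eigenvalues
  have hform (x : Fin d → ℝ) : x ⬝ᵥ M *ᵥ x = ∑ a, l a * (u a ⬝ᵥ x) ^ 2 := by
    rw [hMu, sum_mulVec, dotProduct_sum]
    refine Finset.sum_congr rfl fun a _ => ?_
    rw [smul_mulVec, vecMulVec_mulVec, dotProduct_smul, dotProduct_smul, dotProduct_comm x]
    simp [pow_two]
  have hform2 (x : Fin d → ℝ) : (x ⬝ᵥ M *ᵥ x) ^ 2 =
      ∑ a, ∑ b, l a * l b * ((u a ⬝ᵥ x) ^ 2 * (u b ⬝ᵥ x) ^ 2) := by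
    simp only [hform, pow_two (Finset.sum _ _), Finset.sum_mul_sum, mul_mul_mul_comm]
  have htr : M.trace = ∑ a, l a := by
    rw [hMu, trace_sum]
    simp [trace_vecMulVec, hu]
  have htr2 : (M * M).trace = ∑ a, l a ^ 2 := by
    rw [hMu, Finset.sum_mul_sum, trace_sum]
    simp only [trace_sum, smul_mul_smul_comm, vecMulVec_mul_vecMulVec, trace_smul, trace_vecMulVec,
      dotProduct_smul, hu, smul_eq_mul]
    simp [pow_two]
  have hc := continuous_orthogonalGroup_mulVec v
  have hint (a b : Fin d) :
      Integrable (fun O : orthogonalGroup (Fin d) ℝ =>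
        l a * l b * ((u a ⬝ᵥ (O : Matrix (Fin d) (Fin d) ℝ) *ᵥ v) ^ 2 *
        (u b ⬝ᵥ (O : Matrix (Fin d) (Fin d) ℝ) *ᵥ v) ^ 2)) μ :=
    integrable_orthogonalGroup_of_continuous μ (continuous_const.mul
      (((continuous_const.dotProduct hc).pow 2).mul ((continuous_const.dotProduct hc).pow 2)))
  simp_rw [hform2]
  rw [integral_finsetSum _ fun a _ => integrable_finsetSum _ fun b _ => hint _ _]
  simp_rw [integral_finsetSum _ fun b _ => hint _ _, integral_const_mul,
    integral_sq_dotProduct_mulVec_mul_sq μ hd hv, hu]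
  rw [htr, htr2, pow_two (∑ a, _), Finset.sum_mul_sum, Finset.mul_sum, ← Finset.sum_add_distrib,
    Finset.sum_div]
  refine Finset.sum_congr rfl fun a _ => ?_
  simp_rw [← mul_div_assoc]
  rw [← Finset.sum_div]
  congr 1
  simp [mul_add, Finset.sum_add_distrib]
  ring

/-- The second moment of a symmetric observable in a randomly rotated real state is maximal at
pure states. -/
theorem integral_sq_trace_conj_le (hd : 0 < d) {M S : Matrix (Fin d) (Fin d) ℝ}
    (hM : M.IsHermitian) (hS : S.PosSemidef) (hS1 : S.trace = 1) :
    ∫ O : orthogonalGroup (Fin d) ℝ,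
        ((O : Matrix (Fin d) (Fin d) ℝ) * S * (O : Matrix (Fin d) (Fin d) ℝ)ᵀ * M).trace ^ 2 ∂μ ≤
      (M.trace ^ 2 + 2 * (M * M).trace) / (d * (d + 2)) := by
  obtain ⟨v, hv, hSv⟩ := hS.1.exists_orthonormal_eigenvectors
  have hl := hS.eigenvalues_nonneg
  set l := hS.1.eigenvalues
  have hl1 : ∑ j, l j = 1 := by
    rw [← hS1, hSv, trace_sum]
    simp [trace_vecMulVec, hv]
  have hform (O : orthogonalGroup (Fin d) ℝ) :
      ((O : Matrix (Fin d) (Fin d) ℝ) * S * (O : Matrix (Fin d) (Fin d) ℝ)ᵀ * M).trace =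
      ∑ j, l j * (((O : Matrix (Fin d) (Fin d) ℝ) *ᵥ v j) ⬝ᵥ
        M *ᵥ ((O : Matrix (Fin d) (Fin d) ℝ) *ᵥ v j)) := by
    rw [hSv, Finset.mul_sum, Finset.sum_mul, Finset.sum_mul, trace_sum]
    refine Finset.sum_congr rfl fun j _ => ?_
    rw [Matrix.mul_smul, Matrix.smul_mul, Matrix.smul_mul, trace_smul, smul_eq_mul, mul_vecMulVec, vecMulVec_mul,
      vecMul_transpose, vecMulVec_mul, trace_vecMulVec, dotProduct_comm, ← dotProduct_mulVec]
  have hint (j : Fin d) : Integrable (fun O : orthogonalGroup (Fin d) ℝ =>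
      l j * (((O : Matrix (Fin d) (Fin d) ℝ) *ᵥ v j) ⬝ᵥ
        M *ᵥ ((O : Matrix (Fin d) (Fin d) ℝ) *ᵥ v j)) ^ 2) μ := by
    have hc := continuous_orthogonalGroup_mulVec (v j)
    exact integrable_orthogonalGroup_of_continuous μ (continuous_const.mul
      ((hc.dotProduct (continuous_const.matrix_mulVec hc)).pow 2))
  calc _ ≤ ∫ O : orthogonalGroup (Fin d) ℝ, ∑ j,
        l j * (((O : Matrix (Fin d) (Fin d) ℝ) *ᵥ v j) ⬝ᵥ
        M *ᵥ ((O : Matrix (Fin d) (Fin d) ℝ) *ᵥ v j)) ^ 2 ∂μ := by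
        refine integral_mono_of_nonneg (Filter.Eventually.of_forall fun _ => sq_nonneg _)
          (integrable_finsetSum _ fun j _ => hint j) (Filter.Eventually.of_forall fun O => ?_)
        simp only [hform]
        exact sq_sum_mul_le hl hl1 _
    _ = _ := by
        rw [integral_finsetSum _ fun j _ => hint j]
        simp_rw [integral_const_mul]
        rw [← one_mul (_ / _), ← hl1, Finset.sum_mul]
        refine Finset.sum_congr rfl fun j _ => ?_
        rw [integral_sq_quadraticForm μ hd hM (by simp [hv])]

end SecondMoment

theorem ktensor_mul {d N : ℕ} (X Y : Fin N → Matrix (Fin d) (Fin d) ℂ) :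
    ktensor X * ktensor Y = ktensor fun n => X n * Y n := by
  ext f g
  simp only [ktensor, mul_apply, of_apply, ← Finset.prod_mul_distrib]
  rw [Finset.prod_univ_sum, Fintype.piFinset_univ]

theorem trace_ktensor {d N : ℕ} (X : Fin N → Matrix (Fin d) (Fin d) ℂ) :
    (ktensor X).trace = ∏ n, (X n).trace := by
  simp only [ktensor, trace, diag_apply, of_apply]
  rw [Finset.prod_univ_sum, Fintype.piFinset_univ]

/-- The entrywise real part of a positive semidefinite matrix is positive semidefinite. -/
theorem Matrix.PosSemidef.map_re {d : ℕ} {σ : Matrix (Fin d) (Fin d) ℂ} (hσ : σ.PosSemidef) :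
    (σ.map Complex.re).PosSemidef := by
  rw [posSemidef_iff_dotProduct_mulVec]
  refine ⟨?_, fun x => ?_⟩
  · ext i j
    have := congrArg Complex.re (hσ.1.apply i j)
    simpa using this
  · have := hσ.re_dotProduct_nonneg fun i => (x i : ℂ)
    simpa [dotProduct, mulVec] using this

theorem map_ofReal_map_re {d : ℕ} {M : Matrix (Fin d) (Fin d) ℂ} (hM : M.IsHermitian)
    (hMreal : Mᵀ = M) : (M.map Complex.re).map Complex.ofReal = M := by
  ext i j
  have h1 := hM.apply i j
  have h2 : M j i = M i j := congrFun (congrFun hMreal i) j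
  rw [h2] at h1
  simpa using Complex.conj_eq_iff_re.mp h1

/-- The expectation of a real observable in a rotated state depends only on the real part of the
state. -/
theorem trace_OC_conj {d : ℕ} {σ : Matrix (Fin d) (Fin d) ℂ} (hσ : σ.IsHermitian)
    {M : Matrix (Fin d) (Fin d) ℝ} (hM : M.IsHermitian) (O : orthogonalGroup (Fin d) ℝ) :
    (OC O * σ * (OC O)ᵀ * M.map Complex.ofReal).trace =
      (((O : Matrix (Fin d) (Fin d) ℝ) * σ.map Complex.re *
        (O : Matrix (Fin d) (Fin d) ℝ)ᵀ * M).trace : ℝ) := by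
  have hcyc {R : Type} [CommRing R] (A B C D : Matrix (Fin d) (Fin d) R) :
      (A * B * C * D).trace = (B * (C * D * A)).trace := by
    rw [mul_assoc, mul_assoc, trace_mul_comm, ← mul_assoc, mul_assoc B, mul_assoc]
  rw [hcyc, hcyc]
  set K := (O : Matrix (Fin d) (Fin d) ℝ)ᵀ * M * (O : Matrix (Fin d) (Fin d) ℝ) with hK
  have hKC : (OC O)ᵀ * M.map Complex.ofReal * OC O = K.map Complex.ofReal := by
    change _ = K.map Complex.ofRealHom
    rw [hK, Matrix.map_mul, Matrix.map_mul]
    rfl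
  have hKH : (K.map Complex.ofReal).IsHermitian := by
    have : K.IsHermitian := by
      have := isHermitian_conjTranspose_mul_mul (O : Matrix (Fin d) (Fin d) ℝ) hM
      rwa [conjTranspose_eq_transpose_of_trivial] at this
    ext i j
    simpa using congrArg Complex.ofReal (this.apply i j)
  rw [hKC]
  have hreal : star (σ * K.map Complex.ofReal).trace = (σ * K.map Complex.ofReal).trace := by
    rw [← trace_conjTranspose, conjTranspose_mul, hKH.eq, hσ.eq, trace_mul_comm]
  rw [← Complex.conj_eq_iff_re.mp hreal]
  congr 1
  simp [trace, mul_apply]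

/-- the second moment of real randomized measurements of a fully separable
`N`-qudit state is at most `(2/(d+2))^N`. -/
theorem stmt_16 (d N : ℕ) (hd : 2 ≤ d) (hN : 1 ≤ N)
    [MeasurableSpace (Matrix.orthogonalGroup (Fin d) ℝ)]
    [BorelSpace (Matrix.orthogonalGroup (Fin d) ℝ)]
    (μ : Measure (Matrix.orthogonalGroup (Fin d) ℝ))
    [μ.IsHaarMeasure] [IsProbabilityMeasure μ]
    (M : Matrix (Fin d) (Fin d) ℂ) (hM : M.IsHermitian) (hMreal : Mᵀ = M)
    (hMtr : M.trace = 0) (hM2 : (M * M).trace = (d : ℂ))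
    (ι : Type) [Fintype ι]
    (p : ι → ℝ) (hp : ∀ i, 0 ≤ p i) (hpsum : ∑ i, p i = 1)
    (σ : ι → Fin N → Matrix (Fin d) (Fin d) ℂ)
    (hσpsd : ∀ i n, (σ i n).PosSemidef) (hσtr : ∀ i n, (σ i n).trace = 1)
    (ρ : Matrix (Fin N → Fin d) (Fin N → Fin d) ℂ)
    (hρ : ρ = ∑ i, (p i : ℂ) • ktensor (σ i)) :
    (∫ O, ((ktensor (fun n => OC (O n)) * ρ * ktensor (fun n => (OC (O n))ᵀ) *
          ktensor (fun _ => M)).trace.re) ^ 2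
        ∂(Measure.pi fun _ : Fin N => μ)) ≤
      (2 / ((d : ℝ) + 2)) ^ N := by
  set R := M.map Complex.re with hR
  have hMR : R.map Complex.ofReal = M := map_ofReal_map_re hM hMreal
  have hRH : R.IsHermitian := by
    ext i j
    simpa [hR] using congrArg Complex.re (hM.apply i j)
  have hRtr : R.trace = 0 := by
    simpa [trace, hR] using congrArg Complex.re hMtr
  have hR2 : (R * R).trace = d := by
    rw [← hMR] at hM2
    simpa [trace, mul_apply] using congrArg Complex.re hM2
  let f (i : ι) (n : Fin N) (O : orthogonalGroup (Fin d) ℝ) : ℝ :=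
    ((O : Matrix (Fin d) (Fin d) ℝ) * (σ i n).map Complex.re *
      (O : Matrix (Fin d) (Fin d) ℝ)ᵀ * R).trace
  have hexp (O : Fin N → orthogonalGroup (Fin d) ℝ) :
      (ktensor (fun n => OC (O n)) * ρ * ktensor (fun n => (OC (O n))ᵀ) *
          ktensor (fun _ => M)).trace.re = ∑ i, p i * ∏ n, f i n (O n) := by
    have : (ktensor (fun n => OC (O n)) * ρ * ktensor (fun n => (OC (O n))ᵀ) *
          ktensor (fun _ => M)).trace = ((∑ i, p i * ∏ n, f i n (O n) : ℝ) : ℂ) := by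
      rw [hρ, Finset.mul_sum, Finset.sum_mul, Finset.sum_mul, trace_sum, Complex.ofReal_sum]
      refine Finset.sum_congr rfl fun i _ => ?_
      rw [Matrix.mul_smul, Matrix.smul_mul, Matrix.smul_mul, trace_smul, ktensor_mul, ktensor_mul, ktensor_mul,
        trace_ktensor, smul_eq_mul, Complex.ofReal_mul, Complex.ofReal_prod]
      congr 1
      refine Finset.prod_congr rfl fun n _ => ?_
      rw [← trace_OC_conj (hσpsd i n).1 hRH, hMR]
    rw [this, Complex.ofReal_re]
  have hint (i : ι) : Integrable (fun O : Fin N → orthogonalGroup (Fin d) ℝ =>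
      p i * ∏ n, f i n (O n) ^ 2) (Measure.pi fun _ => μ) :=
    (Integrable.fintype_prod (f := fun n O => f i n O ^ 2) fun n =>
      integrable_orthogonalGroup_of_continuous μ
        ((continuous_trace_conj _ _).pow 2)).const_mul _
  have hd' : (0 : ℝ) < d := by exact_mod_cast (by omega : 0 < d)
  have hsingle (i : ι) (n : Fin N) : ∫ O, f i n O ^ 2 ∂μ ≤ 2 / ((d : ℝ) + 2) := by
    refine (integral_sq_trace_conj_le μ (by omega) hRH (hσpsd i n).map_re ?_).trans_eq ?_
    · simpa [trace] using congrArg Complex.re (hσtr i n)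
    · rw [hRtr, hR2]
      field_simp
      ring
  calc _ ≤ ∫ O, ∑ i, p i * ∏ n, f i n (O n) ^ 2 ∂(Measure.pi fun _ : Fin N => μ) := by
        refine integral_mono_of_nonneg (Filter.Eventually.of_forall fun _ => sq_nonneg _)
          (integrable_finsetSum _ fun i _ => hint i) (Filter.Eventually.of_forall fun O => ?_)
        simp only [hexp, Finset.prod_pow]
        exact sq_sum_mul_le hp hpsum _
    _ = ∑ i, p i * ∏ n, ∫ O, f i n O ^ 2 ∂μ := by
        rw [integral_finsetSum _ fun i _ => hint i]
        refine Finset.sum_congr rfl fun i _ => ?_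
        rw [integral_const_mul, integral_fintype_prod_eq_prod (fun n O => f i n O ^ 2)]
    _ ≤ ∑ i, p i * (2 / ((d : ℝ) + 2)) ^ N := by
        refine Finset.sum_le_sum fun i _ => mul_le_mul_of_nonneg_left ?_ (hp i)
        refine (Finset.prod_le_prod (fun n _ => integral_nonneg fun _ => sq_nonneg _)
          fun n _ => hsingle i n).trans_eq ?_
        simp [div_pow]
    _ = _ := by rw [← Finset.sum_mul, hpsum, one_mul]
end
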